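/- (Gödel, 1932.) There is no finite deterministic matrix ⟨V, D, O⟩ for the propositional language with ⊥, ¬, →, ∧, ∨ — where V is a finite set of truth-values, D ⊆ V, and O assigns to each connective a function on V of the corresponding arity — such that the set of formulas designated under every valuation of the matrix coincides with the set of intuitionistically valid formulas, i.e., the formulas that evaluate to ⊤ in every Heyting algebra under every assignment of the atoms (interpreting ∧ as inf, ∨ as sup, → as Heyting implication, ⊥ as the bottom element, and ¬α as α ⇨ ⊥). -/

import Mathlib

/-- Formulas with `⊥, ¬, →, ∧, ∨`. -/
inductive GForm : Type where
  | atom : ℕ → GForm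
  | bot : GForm
  | neg : GForm → GForm
  | imp : GForm → GForm → GForm
  | conj : GForm → GForm → GForm
  | disj : GForm → GForm → GForm
deriving DecidableEq

/-- Evaluation of a formula in a Heyting algebra, given an assignment of the atoms:
`∧` is inf, `∨` is sup, `→` is Heyting implication, `⊥` is bottom, `¬α` is `α ⇨ ⊥`. -/
def heval {H : Type} [HeytingAlgebra H] (σ : ℕ → H) : GForm → H
  | GForm.atom n => σ n
  | GForm.bot => ⊥
  | GForm.neg a => heval σ a ⇨ ⊥
  | GForm.imp a b => heval σ a ⇨ heval σ b
  | GForm.conj a b => heval σ a ⊓ heval σ b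
  | GForm.disj a b => heval σ a ⊔ heval σ b

/-- Intuitionistic validity: the formula evaluates to `⊤` in every Heyting algebra
under every assignment of the atoms. -/
def IntValid (φ : GForm) : Prop :=
  ∀ (H : Type) [HeytingAlgebra H] (σ : ℕ → H), heval σ φ = ⊤

/-- A deterministic matrix `⟨V, D, O⟩` for the language `⊥, ¬, →, ∧, ∨`. -/
structure DetMatrix : Type 1 where
  V : Type
  D : Set V
  fbot : V
  fneg : V → V
  fimp : V → V → V
  fconj : V → V → V
  fdisj : V → V → V

/-- A valuation of a deterministic matrix: a map commuting with the truth functions. -/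
def DetMatrix.IsVal (M : DetMatrix) (v : GForm → M.V) : Prop :=
  v GForm.bot = M.fbot ∧
  (∀ a, v (GForm.neg a) = M.fneg (v a)) ∧
  (∀ a b, v (GForm.imp a b) = M.fimp (v a) (v b)) ∧
  (∀ a b, v (GForm.conj a b) = M.fconj (v a) (v b)) ∧
  (∀ a b, v (GForm.disj a b) = M.fdisj (v a) (v b))

/-- Tautology of a deterministic matrix: designated under every valuation. -/
def DetMatrix.Taut (M : DetMatrix) (φ : GForm) : Prop :=
  ∀ v : GForm → M.V, M.IsVal v → v φ ∈ M.D

namespace GForm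

/-- The biconditional `(α → β) ∧ (β → α)`. -/
def iff (a b : GForm) : GForm := conj (imp a b) (imp b a)

/-- The disjunction of the biconditionals between the atoms `f i` and `f j`, for `(i, j)` in `L`. -/
def pairsDisj (f : ℕ → ℕ) : List (ℕ × ℕ) → GForm
  | [] => bot
  | p :: L => disj (iff (atom (f p.1)) (atom (f p.2))) (pairsDisj f L)

/-- If some pair of `L` is identified by `f`, the disjunction is intuitionistically valid. -/
theorem intValid_pairsDisj {f : ℕ → ℕ} {L : List (ℕ × ℕ)} {p : ℕ × ℕ} (hp : p ∈ L)
    (hf : f p.1 = f p.2) : IntValid (pairsDisj f L) := by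
  intro H _ σ
  induction L with
  | nil => simp at hp
  | cons q L ih =>
    rcases List.mem_cons.1 hp with rfl | h
    · simp [pairsDisj, iff, heval, hf]
    · simp [pairsDisj, heval, ih h]

/-- If every pair of `L` has distinct entries, the disjunction over `L` fails in the chain `ℕ∞`. -/
theorem not_intValid_pairsDisj_id {L : List (ℕ × ℕ)} (hL : ∀ p ∈ L, p.1 ≠ p.2) :
    ¬ IntValid (pairsDisj id L) := by
  intro h
  refine ne_of_lt ?_ (h ℕ∞ (fun n => (n : ℕ∞)))
  clear h
  induction L with
  | nil => simp [pairsDisj, heval]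
  | cons p L ih =>
    refine max_lt ?_ (ih fun q hq => hL q (List.mem_cons_of_mem _ hq))
    refine lt_top_iff_ne_top.2 fun htop => hL p List.mem_cons_self ?_
    have h : ((p.1 : ℕ∞) ⇨ (p.2 : ℕ∞)) ⊓ ((p.2 : ℕ∞) ⇨ (p.1 : ℕ∞)) = ⊤ := htop
    rw [inf_eq_top_iff, himp_eq_top_iff, himp_eq_top_iff] at h
    exact_mod_cast le_antisymm h.1 h.2

end GForm

/-- A valuation does not distinguish two disjunctions whose atoms have the same values. -/
theorem DetMatrix.IsVal.pairsDisj_congr {M : DetMatrix} {v : GForm → M.V} (hv : M.IsVal v)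
    {f g : ℕ → ℕ} (hfg : ∀ n, v (GForm.atom (f n)) = v (GForm.atom (g n)))
    (L : List (ℕ × ℕ)) : v (GForm.pairsDisj f L) = v (GForm.pairsDisj g L) := by
  obtain ⟨-, -, himp, hconj, hdisj⟩ := hv
  induction L with
  | nil => rfl
  | cons p L ih => simp only [GForm.pairsDisj, GForm.iff, himp, hconj, hdisj, hfg, ih]

theorem godel_no_finite_matrix_for_IPL :
    ¬ ∃ M : DetMatrix, Finite M.V ∧ ∀ φ : GForm, (M.Taut φ ↔ IntValid φ) := by
  rintro ⟨M, hfin, hM⟩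
  have := Fintype.ofFinite M.V
  set L := (Finset.range (Fintype.card M.V + 1)).offDiag.toList with hLdef
  have hL : ∀ p ∈ L, p.1 ≠ p.2 := fun p hp => by
    rw [hLdef, Finset.mem_toList, Finset.mem_offDiag] at hp
    exact hp.2.2
  refine GForm.not_intValid_pairsDisj_id hL ((hM _).1 fun v hv => ?_)
  obtain ⟨i, j, hij, hvij⟩ := Fintype.exists_ne_map_eq_of_card_lt
    (fun k : Fin (Fintype.card M.V + 1) => v (GForm.atom k)) (by simp)
  have hne : (i : ℕ) ≠ j := fun h => hij (Fin.ext h)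
  have hmem : ((i : ℕ), (j : ℕ)) ∈ L := by
    rw [hLdef, Finset.mem_toList, Finset.mem_offDiag]
    exact ⟨Finset.mem_range.2 i.2, Finset.mem_range.2 j.2, hne⟩
  have hcongr : ∀ n, v (GForm.atom (id n)) =
      v (GForm.atom (Function.update id (j : ℕ) (i : ℕ) n)) := by
    intro n
    by_cases hn : n = j
    · subst hn
      simpa using hvij.symm
    · simp [hn]
  rw [hv.pairsDisj_congr hcongr]
  exact (hM _).2 (GForm.intValid_pairsDisj hmem (by simp [hne])) v hv
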